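/- arXiv:math/0301166 — 2 statements merged into one kernel-verified Lean document; each statement's English description precedes it below -/
import Mathlib

section
/- Cramer relations for vector fields tangent to complete intersection curves: Let n ≥ 2, let f_1,…,f_{n−1} be germs at 0 of holomorphic functions ℂⁿ → ℂ vanishing at 0, and let X = Σ_{i=1}^n X_i ∂/∂z_i be a germ of a holomorphic vector field at 0 tangent to f, i.e. there is an (n−1)×(n−1) matrix C = (c_{l,m}) of holomorphic germs with Σ_{i=1}^n (∂f_l/∂z_i)·X_i = Σ_{m=1}^{n−1} c_{l,m}·f_m as germs at 0 for every l. For i = 1,…,n let m_i be the determinant of the (n−1)×(n−1) matrix obtained from the Jacobian matrix (∂f_l/∂z_j)_{l=1,…,n−1; j=1,…,n} by deleting its i-th column. Then for every i = 1,…,n the germ (−1)^i·m_i·X_1 + m_1·X_i lies in the ideal of 𝒪_{ℂⁿ,0} generated by f_1,…,f_{n−1}. -/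
open Filter Topology

/-- The partial derivative `∂g/∂z_i` of a function `g : ℂⁿ → ℂ` at a point `z`. -/
noncomputable def pd {n : ℕ} (i : Fin n) (g : (Fin n → ℂ) → ℂ) (z : Fin n → ℂ) : ℂ :=
  fderiv ℂ g z (Pi.single i 1)

/-- The maximal minor `m_i` of the Jacobian matrix of `f = (f₁, …, f_{n-1}) : ℂⁿ → ℂ^{n-1}`
obtained by deleting its `i`-th column (here `n = q + 1` and indices are `0`-based, the
deleted column being selected by `Fin.succAbove`). -/
noncomputable def jacMinor {q : ℕ} (f : Fin q → (Fin (q + 1) → ℂ) → ℂ)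
    (i : Fin (q + 1)) (z : Fin (q + 1) → ℂ) : ℂ :=
  Matrix.det (Matrix.of fun l j => pd (i.succAbove j) (f l) z : Matrix (Fin q) (Fin q) ℂ)

theorem AnalyticAt.pd {n : ℕ} {g : (Fin n → ℂ) → ℂ} {z : Fin n → ℂ} (hg : AnalyticAt ℂ g z)
    (i : Fin n) : AnalyticAt ℂ (_root_.pd i g) z :=
  ((ContinuousLinearMap.apply ℂ ℂ (Pi.single i 1 : Fin n → ℂ)).analyticAt _).comp hg.fderiv

theorem AnalyticAt.matrix_det {𝕜 E ι : Type*} [NontriviallyNormedField 𝕜]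
    [NormedAddCommGroup E] [NormedSpace 𝕜 E] [Fintype ι] [DecidableEq ι]
    {A : E → Matrix ι ι 𝕜} {z : E} (hA : ∀ i j, AnalyticAt 𝕜 (fun w => A w i j) z) :
    AnalyticAt 𝕜 (fun w => (A w).det) z := by
  simp only [Matrix.det_apply']
  exact Finset.analyticAt_fun_sum _ fun σ _ =>
    analyticAt_const.mul (Finset.analyticAt_fun_prod _ fun i _ => hA _ _)

/-- The `q × (q + 1)` matrix `J` bordered by the top row `(1, 0, …, 0)`. -/
def borderedMatrix {R : Type*} [Zero R] [One R] {q : ℕ} (J : Matrix (Fin q) (Fin (q + 1)) R) :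
    Matrix (Fin (q + 1)) (Fin (q + 1)) R :=
  Matrix.of (Fin.cons (Pi.single 0 1) J)

@[simp]
theorem borderedMatrix_zero {R : Type*} [Zero R] [One R] {q : ℕ}
    (J : Matrix (Fin q) (Fin (q + 1)) R) (j : Fin (q + 1)) :
    borderedMatrix J 0 j = (Pi.single 0 1 : Fin (q + 1) → R) j := rfl

@[simp]
theorem borderedMatrix_succ {R : Type*} [Zero R] [One R] {q : ℕ}
    (J : Matrix (Fin q) (Fin (q + 1)) R) (l : Fin q) (j : Fin (q + 1)) :
    borderedMatrix J l.succ j = J l j := rfl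

open scoped Matrix in
/-- Cramer's rule for an underdetermined `q × (q + 1)` system `J *ᵥ x = b`. -/
theorem borderedMatrix_cramer {R : Type*} [CommRing R] {q : ℕ}
    (J : Matrix (Fin q) (Fin (q + 1)) R) (x : Fin (q + 1) → R) (i : Fin (q + 1)) :
    (-1) ^ ((i : ℕ) + 1) * (J.submatrix id i.succAbove).det * x 0
        + (J.submatrix id Fin.succ).det * x i
      = ∑ l : Fin q, (borderedMatrix J).adjugate i l.succ * ∑ j, J l j * x j := by
  have hdet : (borderedMatrix J).det = (J.submatrix id Fin.succ).det := by
    rw [Matrix.det_succ_row_zero, Fin.sum_univ_succ]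
    simp [Matrix.submatrix]
  have hadj : (borderedMatrix J).adjugate i 0 = (-1) ^ (i : ℕ) *
      (J.submatrix id i.succAbove).det := by
    rw [Matrix.adjugate_fin_succ_eq_det_submatrix]
    simp [Matrix.submatrix]
  have h := congrFun (congrArg (· *ᵥ x) (Matrix.adjugate_mul (borderedMatrix J))) i
  have hz : (borderedMatrix J *ᵥ x) 0 = x 0 := by
    simp [Matrix.mulVec, dotProduct, Pi.single_apply]
  have hs (l : Fin q) : (borderedMatrix J *ᵥ x) l.succ = ∑ j, J l j * x j := by
    simp [Matrix.mulVec, dotProduct]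
  simp only [← Matrix.mulVec_mulVec, Matrix.smul_mulVec, Matrix.one_mulVec, Pi.smul_apply,
    smul_eq_mul] at h
  rw [Matrix.mulVec, dotProduct, Fin.sum_univ_succ, hz, hadj, hdet] at h
  simp only [hs] at h
  rw [← h]
  ring

theorem AnalyticAt.adjugate_borderedMatrix {𝕜 E : Type*} [NontriviallyNormedField 𝕜]
    [NormedAddCommGroup E] [NormedSpace 𝕜 E] {q : ℕ} {J : E → Matrix (Fin q) (Fin (q + 1)) 𝕜}
    {z : E} (hJ : ∀ l j, AnalyticAt 𝕜 (fun w => J w l j) z) (i k : Fin (q + 1)) :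
    AnalyticAt 𝕜 (fun w => (borderedMatrix (J w)).adjugate i k) z := by
  simp only [Matrix.adjugate_fin_succ_eq_det_submatrix]
  refine analyticAt_const.mul (AnalyticAt.matrix_det fun r s => ?_)
  simp only [Matrix.submatrix_apply]
  cases k.succAbove r using Fin.cases with
  | zero => simpa only [borderedMatrix_zero] using analyticAt_const
  | succ l => simpa only [borderedMatrix_succ] using hJ l _

/-- **Cramer relations for vector fields tangent to complete intersection curves.**
Let `n = q + 1 ≥ 2`, let `f₁, …, f_{n-1}` be holomorphic germs at `0 ∈ ℂⁿ` vanishing at `0`,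
and let `X = Σ Xᵢ ∂/∂zᵢ` be a holomorphic vector field tangent to `f`, i.e. `Xf = Cf` near `0`
for an `(n-1) × (n-1)` matrix `C` of holomorphic germs.  With `m_i` the maximal minor of the
Jacobian of `f` obtained by deleting the `i`-th column, for every `i` the germ
`(−1)^i mᵢ X₁ + m₁ Xᵢ` (in `1`-based indexing, i.e. `(−1)^(i+1) mᵢ X₀ + m₀ Xᵢ` in the `0`-based
indexing used here) lies in the ideal of the local ring of holomorphic germs generated by
`f₁, …, f_{n-1}`. -/
theorem cramer_relations_tangent_vf (q : ℕ) (hq : 1 ≤ q)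
    (f : Fin q → (Fin (q + 1) → ℂ) → ℂ) (X : Fin (q + 1) → (Fin (q + 1) → ℂ) → ℂ)
    (c : Fin q → Fin q → (Fin (q + 1) → ℂ) → ℂ)
    (hf : ∀ l, AnalyticAt ℂ (f l) 0) (hf0 : ∀ l, f l 0 = 0)
    (hX : ∀ i, AnalyticAt ℂ (X i) 0)
    (hc : ∀ l m, AnalyticAt ℂ (c l m) 0)
    (htan : ∀ l, ∀ᶠ z in 𝓝 (0 : Fin (q + 1) → ℂ),
      ∑ i, pd i (f l) z * X i z = ∑ m, c l m z * f m z) :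
    ∀ i : Fin (q + 1), ∃ a : Fin q → (Fin (q + 1) → ℂ) → ℂ,
      (∀ l, AnalyticAt ℂ (a l) 0) ∧
      ∀ᶠ z in 𝓝 (0 : Fin (q + 1) → ℂ),
        (-1) ^ ((i : ℕ) + 1) * jacMinor f i z * X 0 z + jacMinor f 0 z * X i z
          = ∑ l, a l z * f l z := by
  intro i
  let J (z : Fin (q + 1) → ℂ) : Matrix (Fin q) (Fin (q + 1)) ℂ := Matrix.of fun l j => pd j (f l) z
  have hJ (l : Fin q) (j : Fin (q + 1)) : AnalyticAt ℂ (fun z => J z l j) 0 := (hf l).pd j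
  refine ⟨fun m z => ∑ l : Fin q, (borderedMatrix (J z)).adjugate i l.succ * c l m z,
    fun m => Finset.analyticAt_fun_sum _ fun l _ =>
      (AnalyticAt.adjugate_borderedMatrix hJ i l.succ).mul (hc l m), ?_⟩
  filter_upwards [eventually_all.2 htan] with z hz
  have h := borderedMatrix_cramer (J z) (fun j => X j z) i
  have hb (l : Fin q) : ∑ j, J z l j * X j z = ∑ m, c l m z * f m z := hz l
  simp only [hb] at h
  refine Eq.trans ?_ (h.trans ?_)
  · simp only [jacMinor, Fin.succAbove_zero]
    rfl
  · simp only [Finset.mul_sum, Finset.sum_mul, mul_assoc]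
    exact Finset.sum_comm
end

section
/- Transformation matrix for residue comparison (core of Lemma 3.2): Let 1 ≤ q < n, let f_1,…,f_q be germs at 0 of holomorphic functions ℂⁿ → ℂ vanishing at 0, and let X = Σ_{i=1}^n X_i ∂/∂z_i be a germ of a holomorphic vector field tangent to f, i.e. Σ_{i=1}^n (∂f_l/∂z_i)·X_i = Σ_{m=1}^q c_{l,m}·f_m near 0 for a q×q matrix C = (c_{l,m}) of holomorphic germs. Fix indices 1 ≤ i_1 < … < i_q ≤ n and let 1 ≤ j_1 < … < j_{n−q} ≤ n be the complementary indices in {1,…,n}. Set DI := det(∂(f_1,…,f_q)/∂(z_{i_1},…,z_{i_q})), DF := det(∂(f_1,…,f_q)/∂(z_{n−q+1},…,z_n)), and let σ_I be the permutation of {1,…,n} sending (1,…,n−q,n−q+1,…,n) to (j_1,…,j_{n−q},i_1,…,i_q). Assume DI(0) ≠ 0. Then there exists an n×n matrix A with entries in 𝒪_{ℂⁿ,0} such that (X_1,…,X_{n−q},f_1,…,f_q)ᵗ = A·(X_{j_1},…,X_{j_{n−q}},f_1,…,f_q)ᵗ and det A = sign(σ_I)·DF/DI as germs at 0. -/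
open Filter Topology

section Analytic

variable {𝕜 E : Type*} [NontriviallyNormedField 𝕜] [NormedAddCommGroup E] [NormedSpace 𝕜 E]
  {n : Type*} [Fintype n] [DecidableEq n] {M : E → Matrix n n 𝕜} {z : E}

theorem AnalyticAt.matrix_det_s2 (hM : ∀ i j, AnalyticAt 𝕜 (fun w => M w i j) z) :
    AnalyticAt 𝕜 (fun w => (M w).det) z := by
  simp only [Matrix.det_apply']
  exact Finset.analyticAt_fun_sum _ fun τ _ =>
    analyticAt_const.mul (Finset.analyticAt_fun_prod _ fun i _ => hM _ _)

theorem AnalyticAt.matrix_inv_apply (hM : ∀ i j, AnalyticAt 𝕜 (fun w => M w i j) z)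
    (hz : (M z).det ≠ 0) (i j : n) : AnalyticAt 𝕜 (fun w => (M w)⁻¹ i j) z := by
  simp only [Matrix.inv_def, Ring.inverse_eq_inv', Matrix.smul_apply, smul_eq_mul,
    Matrix.adjugate_apply]
  refine ((AnalyticAt.matrix_det_s2 hM).inv hz).mul (AnalyticAt.matrix_det_s2 fun k l => ?_)
  by_cases h : k = j
  · subst h
    simpa only [Matrix.updateRow_self] using analyticAt_const
  · simpa only [Matrix.updateRow_ne h] using hM k l

end Analytic

namespace TangentTransformation

open Matrix

variable {m n K : Type*} [Fintype n] [DecidableEq m] [DecidableEq n] [Field K]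

/-- The matrix solving `J x = C y` for the permuted vector `x ∘ s` in terms of its first block
and of `y`. -/
noncomputable def solution (s : Equiv.Perm (m ⊕ n)) (J : Matrix n (m ⊕ n) K)
    (C : Matrix n n K) : Matrix (m ⊕ n) (m ⊕ n) K :=
  fromBlocks 1 0 (-((J.submatrix id (s ∘ Sum.inr))⁻¹ * J.submatrix id (s ∘ Sum.inl)))
    ((J.submatrix id (s ∘ Sum.inr))⁻¹ * C)

/-- The matrix expressing the first block of `x`, together with `y`, through the first block of
`x ∘ s` and `y`, whenever `J x = C y`. -/
noncomputable def transformation (s : Equiv.Perm (m ⊕ n)) (J : Matrix n (m ⊕ n) K)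
    (C : Matrix n n K) : Matrix (m ⊕ n) (m ⊕ n) K :=
  of (Sum.elim (fun r => solution s J C (s.symm (Sum.inl r)))
    (fun l => (1 : Matrix (m ⊕ n) (m ⊕ n) K) (Sum.inr l)))

theorem analyticAt_transformation {𝕜 E : Type*} [NontriviallyNormedField 𝕜]
    [NormedAddCommGroup E] [NormedSpace 𝕜 E] {s : Equiv.Perm (m ⊕ n)}
    {J : E → Matrix n (m ⊕ n) 𝕜} {C : E → Matrix n n 𝕜} {z : E}
    (hJ : ∀ l k, AnalyticAt 𝕜 (fun w => J w l k) z)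
    (hC : ∀ l k, AnalyticAt 𝕜 (fun w => C w l k) z)
    (hD : ((J z).submatrix id (s ∘ Sum.inr)).det ≠ 0) (i j : m ⊕ n) :
    AnalyticAt 𝕜 (fun w => transformation s (J w) (C w) i j) z := by
  have hinv := AnalyticAt.matrix_inv_apply (M := fun w => (J w).submatrix id (s ∘ Sum.inr))
    (fun _ _ => hJ _ _) hD
  rcases i with r | l
  · simp only [transformation, of_apply, Sum.elim_inl, solution]
    rcases s.symm (Sum.inl r) with u | u <;> rcases j with t | t
    · exact analyticAt_const
    · exact analyticAt_const
    · simp only [fromBlocks_apply₂₁, Matrix.neg_apply, mul_apply]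
      exact (Finset.analyticAt_fun_sum _ fun k _ => (hinv u k).mul (hJ _ _)).neg
    · simp only [fromBlocks_apply₂₂, mul_apply]
      exact Finset.analyticAt_fun_sum _ fun k _ => (hinv u k).mul (hC _ _)
  · exact analyticAt_const

variable [Fintype m]

theorem solution_mulVec {s : Equiv.Perm (m ⊕ n)} {J : Matrix n (m ⊕ n) K} {C : Matrix n n K}
    (hD : (J.submatrix id (s ∘ Sum.inr)).det ≠ 0) {x : m ⊕ n → K} {y : n → K}
    (h : J *ᵥ x = C *ᵥ y) :
    solution s J C *ᵥ Sum.elim (x ∘ s ∘ Sum.inl) y = x ∘ s := by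
  have hJ : J.submatrix id (s ∘ Sum.inl) *ᵥ (x ∘ s ∘ Sum.inl) +
      J.submatrix id (s ∘ Sum.inr) *ᵥ (x ∘ s ∘ Sum.inr) = C *ᵥ y := by
    rw [← h]
    ext l
    simp only [Pi.add_apply, mulVec, dotProduct, submatrix_apply, Function.comp_apply, id]
    rw [← Equiv.sum_comp s, Fintype.sum_sum_type]
  rw [solution, fromBlocks_mulVec, Sum.elim_comp_inl, Sum.elim_comp_inr, neg_mulVec,
    ← mulVec_mulVec, ← mulVec_mulVec, ← hJ, mulVec_add, mulVec_mulVec (x ∘ s ∘ Sum.inr),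
    nonsing_inv_mul _ (isUnit_iff_ne_zero.2 hD)]
  ext (i | i) <;> simp

theorem transformation_mulVec {s : Equiv.Perm (m ⊕ n)} {J : Matrix n (m ⊕ n) K}
    {C : Matrix n n K} (hD : (J.submatrix id (s ∘ Sum.inr)).det ≠ 0) {x : m ⊕ n → K}
    {y : n → K} (h : J *ᵥ x = C *ᵥ y) :
    transformation s J C *ᵥ Sum.elim (x ∘ s ∘ Sum.inl) y = Sum.elim (x ∘ Sum.inl) y := by
  ext (r | l)
  · have := congrFun (solution_mulVec hD h) (s.symm (Sum.inl r))
    rw [Function.comp_apply, Equiv.apply_symm_apply] at this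
    exact this
  · exact congrFun (one_mulVec (Sum.elim (x ∘ s ∘ Sum.inl) y)) (Sum.inr l)

theorem det_transformation {s : Equiv.Perm (m ⊕ n)} {J : Matrix n (m ⊕ n) K}
    {C : Matrix n n K} (hD : (J.submatrix id (s ∘ Sum.inr)).det ≠ 0) :
    (transformation s J C).det =
      ((Equiv.Perm.sign s : ℤ) : K) * (J.submatrix id Sum.inr).det /
        (J.submatrix id (s ∘ Sum.inr)).det := by
  set D := J.submatrix id (s ∘ Sum.inr) with hDdef
  set P := J.submatrix id (s ∘ Sum.inl) with hPdef
  have hA : (transformation s J C).det = (transformation s J 1).det := by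
    have key : ∀ C' : Matrix n n K, transformation s J C' =
        fromBlocks (of fun r t => solution s J 0 (s.symm (Sum.inl r)) (Sum.inl t))
          (of fun r l => solution s J C' (s.symm (Sum.inl r)) (Sum.inr l)) 0 1 := by
      intro C'
      ext (r | l) (t | k)
      · simp only [transformation, of_apply, Sum.elim_inl, fromBlocks_apply₁₁]
        rcases s.symm (Sum.inl r) with u | u <;> rfl
      · rfl
      · simp [transformation]
      · simp [transformation, one_apply]
    rw [key C, key 1, det_fromBlocks_zero₂₁, det_fromBlocks_zero₂₁]
  have hE : (solution s J 1).det = D.det⁻¹ := by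
    rw [solution, det_fromBlocks_zero₁₂, det_one, one_mul, mul_one, det_nonsing_inv,
      Ring.inverse_eq_inv']
  have hmul : fromBlocks 1 0 (J.submatrix id Sum.inl) (J.submatrix id Sum.inr) *
      (solution s J 1).submatrix s.symm id = transformation s J 1 := by
    have hrow : J * (solution s J 1).submatrix s.symm id = fromCols 0 1 := by
      have hJ : J.submatrix id s = fromCols P D := by
        ext l (t | t) <;> rfl
      have hJs : J * (solution s J 1).submatrix s.symm id =
          J.submatrix id s * solution s J 1 := by
        ext l k
        simp only [mul_apply, submatrix_apply, id]
        rw [← Equiv.sum_comp s]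
        simp
      rw [hJs, hJ, solution, fromCols_mul_fromBlocks]
      simp only [← hDdef, ← hPdef]
      rw [Matrix.mul_neg, ← Matrix.mul_assoc, mul_one (D⁻¹),
        mul_nonsing_inv _ (isUnit_iff_ne_zero.2 hD)]
      simp
    ext (r | l) k
    · simp [mul_apply, transformation, Fintype.sum_sum_type, one_apply]
    · have := congrFun (congrFun hrow l) k
      rw [mul_apply, Fintype.sum_sum_type] at this
      rw [mul_apply, Fintype.sum_sum_type]
      simp only [fromBlocks_apply₂₁, fromBlocks_apply₂₂]
      refine this.trans ?_
      rcases k with k | k <;> simp [transformation, one_apply]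
  rw [hA, ← hmul, det_mul, det_fromBlocks_zero₁₂, det_one, one_mul, det_permute, hE,
    Equiv.Perm.sign_symm]
  ring

end TangentTransformation

/-- **Transformation matrix for residue comparison (core of Lemma 3.2).**
Let `1 ≤ q < n`, `n = p + q`, let `f₁, …, f_q` be holomorphic germs at `0 ∈ ℂⁿ` vanishing
at `0`, and `X` a holomorphic vector field tangent to `f` (`Xf = Cf` near `0`).  Fix strictly
increasing complementary families of indices `ι : Fin q → Fin n` (the `i`'s) and
`κ : Fin p → Fin n` (the `j`'s), set `DI := det (∂f_l/∂z_{ι m})`,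
`DF := det (∂f_l/∂z_{n−q+m})` (the last `q` columns), and let `σ` be the permutation of
`Fin n` sending the first `p` indices to `κ` and the last `q` indices to `ι`.
If `DI(0) ≠ 0`, then there is an `n × n` matrix `A` of holomorphic germs with
`(X₁, …, X_{n−q}, f₁, …, f_q)ᵗ = A (X_{j₁}, …, X_{j_{n−q}}, f₁, …, f_q)ᵗ` and
`det A = sign(σ) · DF / DI` as germs at `0`. -/
theorem residue_transformation_matrix (p q : ℕ) (hp : 1 ≤ p) (hq : 1 ≤ q)
    (f : Fin q → (Fin (p + q) → ℂ) → ℂ) (X : Fin (p + q) → (Fin (p + q) → ℂ) → ℂ)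
    (c : Fin q → Fin q → (Fin (p + q) → ℂ) → ℂ)
    (hf : ∀ l, AnalyticAt ℂ (f l) 0) (hf0 : ∀ l, f l 0 = 0)
    (hX : ∀ i, AnalyticAt ℂ (X i) 0)
    (hc : ∀ l m, AnalyticAt ℂ (c l m) 0)
    (htan : ∀ l, ∀ᶠ z in 𝓝 (0 : Fin (p + q) → ℂ),
      ∑ i, pd i (f l) z * X i z = ∑ m, c l m z * f m z)
    (ι : Fin q → Fin (p + q)) (κ : Fin p → Fin (p + q))
    (hι : StrictMono ι) (hκ : StrictMono κ)
    (hcompl : Set.range κ = (Set.range ι)ᶜ)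
    (σ : Equiv.Perm (Fin (p + q)))
    (hσ1 : ∀ r : Fin p, σ (Fin.castAdd q r) = κ r)
    (hσ2 : ∀ l : Fin q, σ (Fin.natAdd p l) = ι l)
    (hDI : Matrix.det
      (Matrix.of fun l m => pd (ι m) (f l) 0 : Matrix (Fin q) (Fin q) ℂ) ≠ 0) :
    ∃ A : Fin (p + q) → Fin (p + q) → (Fin (p + q) → ℂ) → ℂ,
      (∀ i j, AnalyticAt ℂ (A i j) 0) ∧
      (∀ᶠ z in 𝓝 (0 : Fin (p + q) → ℂ), ∀ i,
        Fin.append (fun r : Fin p => X (Fin.castAdd q r) z) (fun l : Fin q => f l z) i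
          = ∑ j, A i j z *
              Fin.append (fun r : Fin p => X (κ r) z) (fun l : Fin q => f l z) j) ∧
      (∀ᶠ z in 𝓝 (0 : Fin (p + q) → ℂ),
        Matrix.det (Matrix.of fun i j => A i j z : Matrix (Fin (p + q)) (Fin (p + q)) ℂ)
          = ((Equiv.Perm.sign σ : ℤ) : ℂ) *
              Matrix.det (Matrix.of fun l m =>
                pd (Fin.natAdd p m) (f l) z : Matrix (Fin q) (Fin q) ℂ) /
              Matrix.det (Matrix.of fun l m =>
                pd (ι m) (f l) z : Matrix (Fin q) (Fin q) ℂ)) := by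
  let e : Fin p ⊕ Fin q ≃ Fin (p + q) := finSumFinEquiv
  let s : Equiv.Perm (Fin p ⊕ Fin q) := (e.trans σ).trans e.symm
  let J : (Fin (p + q) → ℂ) → Matrix (Fin q) (Fin p ⊕ Fin q) ℂ :=
    fun z => Matrix.of fun l k => pd (e k) (f l) z
  let C : (Fin (p + q) → ℂ) → Matrix (Fin q) (Fin q) ℂ := fun z => Matrix.of fun l k => c l k z
  have hsl : ∀ r, e (s (Sum.inl r)) = κ r := fun r => by simp [s, e, hσ1]
  have hsr : ∀ l, e (s (Sum.inr l)) = ι l := fun l => by simp [s, e, hσ2]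
  have hsign : Equiv.Perm.sign s = Equiv.Perm.sign σ := Equiv.Perm.sign_symm_trans_trans σ e.symm
  have hD : ∀ z, (J z).submatrix id (s ∘ Sum.inr) = Matrix.of fun l m => pd (ι m) (f l) z := by
    intro z
    ext l k
    simp [J, hsr]
  have hJ : ∀ l k, AnalyticAt ℂ (fun z => J z l k) 0 := fun l k => (hf l).pd (e k)
  have hD0 : ∀ᶠ z in 𝓝 0, ((J z).submatrix id (s ∘ Sum.inr)).det ≠ 0 :=
    (AnalyticAt.matrix_det_s2 (M := fun z => (J z).submatrix id (s ∘ Sum.inr))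
      fun _ _ => hJ _ _).continuousAt.eventually_ne (by rwa [hD])
  refine ⟨fun i j z => TangentTransformation.transformation s (J z) (C z) (e.symm i) (e.symm j),
    fun i j => TangentTransformation.analyticAt_transformation hJ hc (by rwa [hD]) _ _, ?_, ?_⟩
  · filter_upwards [hD0, eventually_all.2 htan] with z hz ht i
    have h : (J z).mulVec (fun k => X (e k) z) = (C z).mulVec fun l => f l z := by
      ext l
      exact (Equiv.sum_comp e fun k => pd k (f l) z * X k z).trans (ht l)
    have key := congrFun (TangentTransformation.transformation_mulVec hz h) (e.symm i)
    obtain ⟨i, rfl⟩ := e.surjective i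
    rw [← Equiv.sum_comp e]
    simp only [Equiv.symm_apply_apply] at key ⊢
    have happ : ∀ (u : Fin p → ℂ) (v : Fin q → ℂ) k, Fin.append u v (e k) = Sum.elim u v k := by
      rintro u v (k | k) <;> simp [e]
    simp only [happ]
    have hx : (fun k => X (e k) z) ∘ s ∘ Sum.inl = fun r => X (κ r) z := by
      ext r
      simp [hsl]
    rw [hx] at key
    exact key.symm
  · filter_upwards [hD0] with z hz
    have key := TangentTransformation.det_transformation (C := C z) hz
    rw [hD, hsign] at key
    exact (Matrix.det_submatrix_equiv_self e.symm _).trans key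
end
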